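/- arXiv:2010.10066 — 3 statements merged into one kernel-verified Lean document; each statement's English description precedes it below -/
import Mathlib

section
/- For all integers n, m with 1 ≤ n ≤ 4 and m ≥ 1, and every signature σ on the grid graph P_n □ P_m, the signed grid (P_n □ P_m, σ) satisfies χ_s(P_n □ P_m, σ) ≤ 5. -/
open SimpleGraph

/-- Two signatures on a graph `G` are equivalent (`σ₂` is obtained from `σ₁` by
switching the set of vertices `{v | s v = true}`); signs are encoded by `Bool`,
with `true` meaning negative, so that the product of signs is `xor`. -/
def SigEquiv {V : Type*} (G : SimpleGraph V) (σ₁ σ₂ : V → V → Bool) : Prop :=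
  ∃ s : V → Bool, ∀ u v, G.Adj u v → σ₂ u v = xor (σ₁ u v) (xor (s u) (s v))

/-- A homomorphism of signed graphs `(G, σ) → (H, π)`: a graph homomorphism
mapping some switching-equivalent signature of `σ` to `π`. -/
def SHom {V W : Type*} (G : SimpleGraph V) (σ : V → V → Bool)
    (H : SimpleGraph W) (π : W → W → Bool) : Prop :=
  ∃ (φ : G →g H) (σ' : V → V → Bool),
    SigEquiv G σ σ' ∧ ∀ u v, G.Adj u v → π (φ u) (φ v) = σ' u v

/-- The chromatic number of a signed graph: the least number of vertices of a
signed graph to which it admits a homomorphism of signed graphs. -/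
noncomputable def sChrom {V : Type*} (G : SimpleGraph V) (σ : V → V → Bool) : ℕ :=
  sInf {n : ℕ | ∃ (H : SimpleGraph (Fin n)) (π : Fin n → Fin n → Bool), SHom G σ H π}

/-- The signature on the complete graph on `Fin 5` whose negative edges form a pentagon. -/
def pentagonSign (a b : Fin 5) : Bool := decide (b = a + 1 ∨ a = b + 1)

theorem pentagonSign_comm (a b : Fin 5) : pentagonSign a b = pentagonSign b a := by
  simp only [pentagonSign, or_comm]

/-- `x` and `y`, each a colour together with a switching bit, are admissible values for the
endpoints of an edge of sign `e`. -/
def Compatible (e : Bool) (x y : Fin 5 × Bool) : Prop :=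
  x.1 ≠ y.1 ∧ pentagonSign x.1 y.1 = xor e (xor x.2 y.2)

theorem Compatible.symm {e : Bool} {x y : Fin 5 × Bool} (h : Compatible e x y) :
    Compatible e y x :=
  ⟨h.1.symm, by rw [pentagonSign_comm, h.2, Bool.xor_comm x.2]⟩

theorem sChrom_le_five_of_compatible {V : Type*} {G : SimpleGraph V} {σ : V → V → Bool}
    (f : V → Fin 5 × Bool) (hf : ∀ u v, G.Adj u v → Compatible (σ u v) (f u) (f v)) :
    sChrom G σ ≤ 5 :=
  Nat.sInf_le ⟨⊤, pentagonSign, ⟨fun v => (f v).1, fun {u v} h => (hf u v h).1⟩,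
    fun u v => xor (σ u v) (xor (f u).2 (f v).2), ⟨fun v => (f v).2, fun _ _ _ => rfl⟩,
    fun u v h => (hf u v h).2⟩

/-- The sign of the 4-cycle with consecutive colours `a, b, b', a'`, without its edge `ab`. -/
def pentagonTurn (a b a' b' : Fin 5) : Bool :=
  xor (pentagonSign a' b') (xor (pentagonSign a a') (pentagonSign b b'))

set_option maxRecDepth 100000 in
/-- Every properly coloured 4-vertex path has a disjointly coloured copy next to it realizing
prescribed signs of the three 4-cycles in between. -/
theorem exists_next_colors : ∀ a b c d : Fin 5, a ≠ b → b ≠ c → c ≠ d → ∀ g₁ g₂ g₃ : Bool,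
    ∃ b', b ≠ b' ∧ (∃ a', a ≠ a' ∧ a' ≠ b' ∧ pentagonTurn a b a' b' = g₁) ∧
      ∃ c', c ≠ c' ∧ b' ≠ c' ∧ pentagonTurn b c b' c' = g₂ ∧
        ∃ d', d ≠ d' ∧ c' ≠ d' ∧ pentagonTurn c d c' d' = g₃ := by
  decide

/-- `x` is an admissible column when the vertical edges have the signs `v`. -/
def IsColumn (v : Fin 3 → Bool) (x : Fin 4 → Fin 5 × Bool) : Prop :=
  ∀ i : Fin 3, Compatible (v i) (x i.castSucc) (x i.succ)

theorem exists_isColumn (v : Fin 3 → Bool) : ∃ x, IsColumn v x := by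
  refine ⟨![(0, false), (2, v 0), (0, xor (v 0) (v 1)), (2, xor (v 0) (xor (v 1) (v 2)))],
    fun i => ?_⟩
  fin_cases i <;> cases h₀ : v 0 <;> cases h₁ : v 1 <;> cases h₂ : v 2 <;>
    simp [Compatible, pentagonSign, h₀, h₁, h₂]

theorem eq_of_xor_eq : ∀ p q r e h k s t : Bool,
    xor p (xor q r) = xor e (xor (xor h k) (xor s t)) →
      p = xor e (xor (xor h (xor s q)) (xor k (xor t r))) := by
  decide

theorem IsColumn.exists_next {v : Fin 3 → Bool} {x : Fin 4 → Fin 5 × Bool} (hx : IsColumn v x)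
    (w : Fin 3 → Bool) (h : Fin 4 → Bool) :
    ∃ y, IsColumn w y ∧ ∀ i, Compatible (h i) (x i) (y i) := by
  let g (i : Fin 3) : Bool := xor (w i)
    (xor (xor (h i.castSucc) (h i.succ)) (xor (x i.castSucc).2 (x i.succ).2))
  obtain ⟨b, hb, ⟨a, ha, hab, e₀⟩, c, hc, hbc, e₁, d, hd, hcd, e₂⟩ :=
    exists_next_colors (x 0).1 (x 1).1 (x 2).1 (x 3).1 (hx 0).1 (hx 1).1 (hx 2).1 (g 0) (g 1) (g 2)
  let z : Fin 4 → Fin 5 := ![a, b, c, d]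
  have hxz : ∀ i, (x i).1 ≠ z i := by
    intro i; fin_cases i <;> assumption
  have hz : ∀ i : Fin 3, z i.castSucc ≠ z i.succ := by
    intro i; fin_cases i <;> assumption
  have hg : ∀ i : Fin 3,
      pentagonTurn (x i.castSucc).1 (x i.succ).1 (z i.castSucc) (z i.succ) = g i := by
    intro i; fin_cases i <;> assumption
  refine ⟨fun i => (z i, xor (h i) (xor (x i).2 (pentagonSign (x i).1 (z i)))),
    fun i => ⟨hz i, ?_⟩, fun i => ⟨hxz i, ?_⟩⟩
  · refine eq_of_xor_eq _ _ _ _ _ _ _ _ ?_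
    simpa only [pentagonTurn, g] using hg i
  · have cancel : ∀ p k s : Bool, p = xor k (xor s (xor k (xor s p))) := by decide
    exact cancel _ _ _

/-- Columns can be coloured one after another. -/
theorem exists_columns (v : ℕ → Fin 3 → Bool) (h : ℕ → Fin 4 → Bool) :
    ∃ x : ℕ → Fin 4 → Fin 5 × Bool, (∀ j, IsColumn (v j) (x j)) ∧
      ∀ j i, Compatible (h j i) (x j i) (x (j + 1) i) := by
  choose next hnext using fun (j : ℕ) (x : {x // IsColumn (v j) x}) =>
    x.2.exists_next (v (j + 1)) (h j)
  obtain ⟨x₀, hx₀⟩ := exists_isColumn (v 0)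
  let X (j : ℕ) : {x // IsColumn (v j) x} :=
    Nat.rec ⟨x₀, hx₀⟩ (fun j x => ⟨next j x, (hnext j x).1⟩) j
  exact ⟨fun j => (X j).1, fun j => (X j).2, fun j => (hnext j (X j)).2⟩

/-- Every signed grid with at most `4` rows has chromatic number at most `5`. -/
theorem chrom_signed_grid_le_five (n m : ℕ) (hn : 1 ≤ n) (hn4 : n ≤ 4) (hm : 1 ≤ m)
    (σ : Fin n × Fin m → Fin n × Fin m → Bool) (hσ : ∀ p q, σ p q = σ q p) :
    sChrom (pathGraph n □ pathGraph m) σ ≤ 5 := by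
  have : NeZero n := ⟨by omega⟩
  have : NeZero m := ⟨by omega⟩
  let p (i j : ℕ) : Fin n × Fin m := (Fin.ofNat n i, Fin.ofNat m j)
  have hp (u : Fin n × Fin m) : p u.1 u.2 = u := by simp [p]
  obtain ⟨x, hv, hh⟩ := exists_columns (fun j i => σ (p i j) (p (i + 1) j))
    (fun j i => σ (p i j) (p i (j + 1)))
  let f (u : Fin n × Fin m) : Fin 5 × Bool := x u.2 (u.1.castLE hn4)
  have vertical (u w : Fin n × Fin m) (h₁ : u.1.val + 1 = w.1.val) (h₂ : u.2 = w.2) :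
      Compatible (σ u w) (f u) (f w) := by
    have key := hv u.2 ⟨u.1, by omega⟩
    have hw : p (u.1 + 1) u.2 = w := by rw [h₁, h₂, hp]
    have hi : (⟨u.1, by omega⟩ : Fin 3).succ = w.1.castLE hn4 := Fin.ext h₁
    simp only [hp, hw, hi] at key
    rwa [show f w = x u.2 (w.1.castLE hn4) by rw [h₂]]
  have horizontal (u w : Fin n × Fin m) (h₁ : u.2.val + 1 = w.2.val) (h₂ : u.1 = w.1) :
      Compatible (σ u w) (f u) (f w) := by
    have key := hh u.2 (u.1.castLE hn4)
    simp only [Fin.val_castLE, hp, h₁] at key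
    rw [h₂, hp, ← h₂] at key
    rwa [show f w = x w.2 (u.1.castLE hn4) by rw [h₂]]
  refine sChrom_le_five_of_compatible f fun u w huw => ?_
  rw [boxProd_adj, pathGraph_adj, pathGraph_adj] at huw
  rcases huw with ⟨h | h, h'⟩ | ⟨h | h, h'⟩
  · exact vertical u w h h'
  · exact hσ w u ▸ (vertical w u h h'.symm).symm
  · exact horizontal u w h h'
  · exact hσ w u ▸ (horizontal w u h h'.symm).symm
end

section
/- If (G₁,σ₁), …, (G_k,σ_k) are signed graphs (k ≥ 1), then χ_s((G₁,σ₁) □ ⋯ □ (G_k,σ_k)) ≤ ∏_{i=1}^{k} χ_s(G_i,σ_i). -/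
open SimpleGraph

/-- A (finite) signed graph, bundled. -/
structure SGraph : Type 1 where
  V : Type
  [fintypeV : Fintype V]
  [decEqV : DecidableEq V]
  graph : SimpleGraph V
  sign : V → V → Bool
  sign_symm : ∀ u v, sign u v = sign v u

attribute [instance] SGraph.fintypeV SGraph.decEqV

/-- Cartesian product of bundled signed graphs. -/
def SGraph.box (G H : SGraph) : SGraph where
  V := G.V × H.V
  graph := G.graph □ H.graph
  sign := fun p q => if p.1 = q.1 then H.sign p.2 q.2 else G.sign p.1 q.1
  sign_symm := by
    intro u v
    show (if u.1 = v.1 then _ else _) = (if v.1 = u.1 then _ else _)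
    by_cases h : u.1 = v.1
    · rw [if_pos h, if_pos h.symm, H.sign_symm]
    · rw [if_neg h, if_neg (fun hh => h hh.symm), G.sign_symm]

/-- The one-vertex signed graph (the unit of the Cartesian product up to
switching isomorphism). -/
def SGraph.unit : SGraph where
  V := Fin 1
  graph := ⊥
  sign := fun _ _ => false
  sign_symm := fun _ _ => rfl

/-- Iterated Cartesian product of a list of signed graphs. -/
def SGraph.listProd (l : List SGraph) : SGraph := l.foldr SGraph.box SGraph.unit

/-- Switching isomorphism of bundled signed graphs. -/
def SGraph.SwitchIso (G H : SGraph) : Prop :=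
  ∃ (e : G.graph ≃g H.graph) (s : G.V → Bool),
    ∀ u v, G.graph.Adj u v → H.sign (e u) (e v) = xor (G.sign u v) (xor (s u) (s v))

def SGraph.HasEdge (G : SGraph) : Prop := ∃ u v, G.graph.Adj u v

/-- `D` is an s-decomposition of `G`: a multiset of signed graphs, each with at
least one edge, whose Cartesian product is switching-isomorphic to `G`. -/
def SGraph.IsSDecomp (G : SGraph) (D : Multiset SGraph) : Prop :=
  (∀ H ∈ D, H.HasEdge) ∧
  ∃ l : List SGraph, (l : Multiset SGraph) = D ∧ G.SwitchIso (SGraph.listProd l)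

/-- A signed graph is s-prime if it is not switching-isomorphic to the
Cartesian product of two signed graphs each on at least two vertices. -/
def SGraph.SPrime (G : SGraph) : Prop :=
  ¬ ∃ A B : SGraph, 2 ≤ Fintype.card A.V ∧ 2 ≤ Fintype.card B.V ∧ G.SwitchIso (A.box B)

/-- A prime s-decomposition: an s-decomposition all of whose factors are
s-prime. -/
def SGraph.IsPrimeSDecomp (G : SGraph) (D : Multiset SGraph) : Prop :=
  G.IsSDecomp D ∧ ∀ H ∈ D, H.SPrime

/-- A homomorphism of signed graphs amounts to a graph homomorphism together with a switching
function relating the two signatures. -/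
theorem sHom_iff {V W : Type*} {G : SimpleGraph V} {σ : V → V → Bool}
    {H : SimpleGraph W} {π : W → W → Bool} :
    SHom G σ H π ↔ ∃ (φ : G →g H) (s : V → Bool),
      ∀ u v, G.Adj u v → π (φ u) (φ v) = xor (σ u v) (xor (s u) (s v)) := by
  constructor
  · rintro ⟨φ, σ', ⟨s, hs⟩, hφ⟩
    exact ⟨φ, s, fun u v h => (hφ u v h).trans (hs u v h)⟩
  · rintro ⟨φ, s, hs⟩
    exact ⟨φ, _, ⟨s, fun _ _ _ => rfl⟩, hs⟩

theorem SHom.refl {V : Type*} (G : SimpleGraph V) (σ : V → V → Bool) : SHom G σ G σ :=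
  sHom_iff.2 ⟨Hom.id, fun _ => false, fun _ _ _ => by simp⟩

theorem SHom.sChrom_le_card {V W : Type*} [Fintype W] {G : SimpleGraph V} {σ : V → V → Bool}
    {H : SimpleGraph W} {π : W → W → Bool} (h : SHom G σ H π) :
    sChrom G σ ≤ Fintype.card W := by
  obtain ⟨φ, s, hs⟩ := sHom_iff.1 h
  let e := Fintype.equivFin W
  refine Nat.sInf_le ⟨H.map e.toEmbedding, fun a b => π (e.symm a) (e.symm b), sHom_iff.2
    ⟨(Iso.map e H).toHom.comp φ, s, fun u v huv => ?_⟩⟩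
  have he : ∀ u, e.symm (((Iso.map e H).toHom.comp φ) u) = φ u := fun u =>
    e.symm_apply_apply (φ u)
  simpa only [he] using hs u v huv

/-- The chromatic number of a finite signed graph is attained. -/
theorem exists_sHom_fin_sChrom {V : Type*} [Fintype V] (G : SimpleGraph V) (σ : V → V → Bool) :
    ∃ (H : SimpleGraph (Fin (sChrom G σ))) (π : Fin (sChrom G σ) → Fin (sChrom G σ) → Bool),
      SHom G σ H π := by
  refine Nat.sInf_mem (s := {n : ℕ | ∃ (H : SimpleGraph (Fin n)) (π : Fin n → Fin n → Bool),
    SHom G σ H π}) ⟨Fintype.card V, ?_⟩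
  let e := Fintype.equivFin V
  refine ⟨G.map e.toEmbedding, fun a b => σ (e.symm a) (e.symm b), sHom_iff.2
    ⟨(Iso.map e G).toHom, fun _ => false, fun u v _ => ?_⟩⟩
  simp

/-- Homomorphisms of signed graphs from two factors induce one from their Cartesian product. -/
theorem SHom.box {A B : SGraph} {W X : Type*} [DecidableEq W]
    {H : SimpleGraph W} {π : W → W → Bool} {K : SimpleGraph X} {ρ : X → X → Bool}
    (hA : SHom A.graph A.sign H π) (hB : SHom B.graph B.sign K ρ) :
    SHom (A.box B).graph (A.box B).sign (H □ K)
      (fun p q => if p.1 = q.1 then ρ p.2 q.2 else π p.1 q.1) := by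
  obtain ⟨φ, s, hs⟩ := sHom_iff.1 hA
  obtain ⟨ψ, t, ht⟩ := sHom_iff.1 hB
  have map_adj : ∀ p q : A.V × B.V, (A.graph □ B.graph).Adj p q →
      (H □ K).Adj (φ p.1, ψ p.2) (φ q.1, ψ q.2) := by
    rintro ⟨a, b⟩ ⟨a', b'⟩ h
    rw [boxProd_adj] at h ⊢
    rcases h with ⟨h, rfl⟩ | ⟨h, rfl⟩
    · exact Or.inl ⟨φ.map_adj h, rfl⟩
    · exact Or.inr ⟨ψ.map_adj h, rfl⟩
  refine sHom_iff.2 ⟨⟨fun p => (φ p.1, ψ p.2), fun {p q} h => map_adj p q h⟩,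
    fun p => xor (s p.1) (t p.2), ?_⟩
  rintro ⟨a, b⟩ ⟨a', b'⟩ h
  change (if φ a = φ a' then ρ (ψ b) (ψ b') else π (φ a) (φ a')) =
    xor (if a = a' then B.sign b b' else A.sign a a') (xor (xor (s a) (t b)) (xor (s a') (t b')))
  rcases boxProd_adj.1 h with ⟨haa, hb⟩ | ⟨hbb, ha⟩
  · dsimp only at haa hb
    subst hb
    rw [if_neg (φ.map_adj haa).ne, if_neg haa.ne, hs a a' haa]
    cases t b <;> simp
  · dsimp only at hbb ha
    subst ha
    rw [if_pos rfl, if_pos rfl, ht b b' hbb]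
    cases s a <;> simp

theorem sChrom_box_le (A B : SGraph) :
    sChrom (A.box B).graph (A.box B).sign ≤
      sChrom A.graph A.sign * sChrom B.graph B.sign := by
  obtain ⟨_, _, hA⟩ := exists_sHom_fin_sChrom A.graph A.sign
  obtain ⟨_, _, hB⟩ := exists_sHom_fin_sChrom B.graph B.sign
  simpa using (hA.box hB).sChrom_le_card

theorem sChrom_unit_le : sChrom SGraph.unit.graph SGraph.unit.sign ≤ 1 :=
  (SHom.refl SGraph.unit.graph SGraph.unit.sign).sChrom_le_card.trans_eq (Fintype.card_fin 1)

/-- The chromatic number of a Cartesian product of signed graphs is at most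
the product of the chromatic numbers of the factors. -/
theorem chrom_listProd_le (k : ℕ) (hk : 1 ≤ k) (l : List SGraph) (hl : l.length = k) :
    sChrom (SGraph.listProd l).graph (SGraph.listProd l).sign ≤
      (l.map fun G => sChrom G.graph G.sign).prod := by
  clear hk hl
  induction l with
  | nil => exact sChrom_unit_le
  | cons A l ih =>
    rw [List.map_cons, List.prod_cons]
    exact (sChrom_box_le A (SGraph.listProd l)).trans (Nat.mul_le_mul_left _ ih)
end

section
/- Let (C₁,σ₁) and (C₂,σ₂) be signed cycles of lengths m, n ≥ 3 and let χ = χ_s((C₁,σ₁) □ (C₂,σ₂)). Then: χ = 2 if both cycles are balanced of even length; χ = 4 if both cycles have even length and at least one of them is unbalanced; χ = 3 if one cycle is balanced of even length and the other has odd length, or if both cycles have odd length and are either both balanced or both unbalanced; and χ = 5 in all remaining cases, namely when one cycle is unbalanced of even length and the other has odd length, or when one cycle is balanced of odd length and the other is unbalanced of odd length. -/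
open SimpleGraph

/-- The signature of the Cartesian (box) product of two signed graphs:
a copy of an edge of `H` inside a `G`-fiber keeps its sign, and vice versa. -/
def prodSign {V W : Type*} [DecidableEq V] (σ : V → V → Bool) (π : W → W → Bool)
    (p q : V × W) : Bool :=
  if p.1 = q.1 then π p.2 q.2 else σ p.1 q.1

/-- The successor of a vertex of the cycle on `Fin n`. -/
def cycleSucc {n : ℕ} (i : Fin n) : Fin n :=
  ⟨(i.val + 1) % n, Nat.mod_lt _ (Nat.lt_of_le_of_lt (Nat.zero_le _) i.isLt)⟩

/-- A signature on the cycle of length `n` is balanced when the number of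
negative edges is even, i.e. the product of the signs of its edges is `+1`. -/
def BalancedCycleSign (n : ℕ) (σ : Fin n → Fin n → Bool) : Prop :=
  (Finset.univ.filter (fun i : Fin n => σ i (cycleSucc i) = true)).card % 2 = 0

/-- The sign of an edge as an element of `ZMod 2`. -/
def signBit (b : Bool) : ZMod 2 := if b then 1 else 0

/-- First character of the dihedral group of order 8. -/
def dihedralFst : DihedralGroup 4 → ZMod 2
  | .r _ => 0
  | .sr _ => 1

/-- Second character of the dihedral group of order 8. -/
def dihedralSnd : DihedralGroup 4 → ZMod 2
  | .r i => i.cast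
  | .sr i => i.cast + 1

theorem dihedralFst_mul : ∀ x y, dihedralFst (x * y) = dihedralFst x + dihedralFst y := by
  decide

theorem dihedralSnd_mul : ∀ x y, dihedralSnd (x * y) = dihedralSnd x + dihedralSnd y := by
  decide

theorem dihedral_det_eq_of_commute : ∀ x y : DihedralGroup 4, x * y = y * x →
    dihedralFst x * dihedralSnd y = dihedralFst y * dihedralSnd x := by
  decide

/-- Label the edges of `K₄` by `sr 0` on `ab`, by `sr 1` on the disjoint edge, and by `1` on the
remaining four edges. -/
def matchingLabel (a b : Fin 4) (u v : Fin 4) : DihedralGroup 4 :=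
  if (u = a ∨ u = b) ∧ (v = a ∨ v = b) then DihedralGroup.sr 0
  else if (u = a ∨ u = b) ∨ (v = a ∨ v = b) then 1
  else DihedralGroup.sr 1

/-- The sign function of `K₄` which is trivial at `0` and takes the values `x`, `y`, `z` on the
edges `12`, `13`, `23`. -/
def rootedSign (x y z : ZMod 2) (u v : Fin 4) : ZMod 2 :=
  if u = 0 ∨ v = 0 then 0
  else if u ≠ 3 ∧ v ≠ 3 then x else if u ≠ 2 ∧ v ≠ 2 then y else z

/-- A labelling `g` of the edges of `K₄` by the dihedral group of order 8 which is trivial on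
positive closed 4-walks, whose characters are cohomologous to `1` and to the sign function `τ`. -/
def IsDihedralLabel (τ : Fin 4 → Fin 4 → ZMod 2) (g : Fin 4 → Fin 4 → DihedralGroup 4)
    (δ s : Fin 4 → ZMod 2) : Prop :=
  (∀ a b, a ≠ b → dihedralFst (g a b) = 1 + δ a + δ b ∧
    dihedralSnd (g a b) = τ a b + s a + s b) ∧
  ∀ a b c d, a ≠ b → b ≠ d → a ≠ c → c ≠ d → τ a b + τ b d = τ a c + τ c d →
    g a b * g b d = g a c * g c d

instance (τ g δ s) : Decidable (IsDihedralLabel τ g δ s) := by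
  unfold IsDihedralLabel; infer_instance

theorem exists_isDihedralLabel_rootedSign (x y z : ZMod 2) :
    ∃ g δ s, IsDihedralLabel (rootedSign x y z) g δ s := by
  have h2 : ∀ t : ZMod 2, t = 0 ∨ t = 1 := by decide
  rcases h2 x with rfl | rfl <;> rcases h2 y with rfl | rfl <;> rcases h2 z with rfl | rfl
  · exact ⟨fun _ _ => DihedralGroup.sr 1, 0, 0, by decide +kernel⟩
  · exact ⟨matchingLabel 2 3, ![1, 1, 0, 0], 0, by decide +kernel⟩
  · exact ⟨matchingLabel 1 3, ![1, 0, 1, 0], 0, by decide +kernel⟩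
  · exact ⟨matchingLabel 0 3, ![0, 1, 1, 0], ![0, 0, 0, 1], by decide +kernel⟩
  · exact ⟨matchingLabel 1 2, ![1, 0, 0, 1], 0, by decide +kernel⟩
  · exact ⟨matchingLabel 0 2, ![0, 1, 0, 1], ![0, 0, 1, 0], by decide +kernel⟩
  · exact ⟨matchingLabel 0 1, ![0, 0, 1, 1], ![0, 1, 0, 0], by decide +kernel⟩
  · exact ⟨fun _ _ => DihedralGroup.sr 0, 0, ![1, 0, 0, 0], by decide +kernel⟩

theorem exists_isDihedralLabel (τ : Fin 4 → Fin 4 → ZMod 2) (hτ : ∀ a b, τ a b = τ b a) :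
    ∃ g δ s, IsDihedralLabel τ g δ s := by
  set r : Fin 4 → ZMod 2 := ![0, τ 0 1, τ 0 2, τ 0 3] with hr
  have h2 : ∀ t : ZMod 2, t + t = 0 := by decide
  have key : ∀ a b, a ≠ b → rootedSign (τ 1 2 + r 1 + r 2) (τ 1 3 + r 1 + r 3)
      (τ 2 3 + r 2 + r 3) a b = τ a b + r a + r b := by
    have h10 := hτ 1 0
    have h20 := hτ 2 0
    have h30 := hτ 3 0
    have h21 := hτ 2 1
    have h31 := hτ 3 1
    have h32 := hτ 3 2
    intro a b hab
    fin_cases a <;> fin_cases b <;> simp [rootedSign, *] at hab ⊢ <;> grind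
  obtain ⟨g, δ, s, h1, h4⟩ := exists_isDihedralLabel_rootedSign (τ 1 2 + r 1 + r 2)
    (τ 1 3 + r 1 + r 3) (τ 2 3 + r 2 + r 3)
  refine ⟨g, δ, fun a => r a + s a, fun a b hab => ⟨(h1 a b hab).1, ?_⟩, ?_⟩
  · rw [(h1 a b hab).2, key a b hab]; ring
  · intro a b c d hab hbd hac hcd h
    apply h4 a b c d hab hbd hac hcd
    rw [key _ _ hab, key _ _ hbd, key _ _ hac, key _ _ hcd]
    grind

/-- Transport around a grid: if all unit squares commute, so does the boundary rectangle. -/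
theorem prod_range_mul_prod_range {M : Type*} [Monoid M] (h v : ℕ → ℕ → M)
    (hsq : ∀ i j, h i j * v (i + 1) j = v i j * h i (j + 1)) (m n : ℕ) :
    ((List.range m).map (h · 0)).prod * ((List.range n).map (v m)).prod =
      ((List.range n).map (v 0)).prod * ((List.range m).map (h · n)).prod := by
  have row : ∀ j m, ((List.range m).map (h · j)).prod * v m j =
      v 0 j * ((List.range m).map (h · (j + 1))).prod := by
    intro j m
    induction m with
    | zero => simp
    | succ m ih =>
      rw [List.prod_range_succ, List.prod_range_succ, mul_assoc, hsq, ← mul_assoc, ih, mul_assoc]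
  induction n with
  | zero => simp
  | succ n ih =>
    rw [List.prod_range_succ, List.prod_range_succ, ← mul_assoc, ih, mul_assoc, row, ← mul_assoc]


theorem signBit_xor (a b : Bool) : signBit (xor a b) = signBit a + signBit b := by
  revert a b; decide

theorem ZMod.two_add_self (t : ZMod 2) : t + t = 0 := by
  revert t; decide

/-- The data of a homomorphism of the signed graph `(G, σ)` to a signed graph on `Fin k` with
signature `π`: a proper colouring `c` and a switching function `s`. -/
def IsSignedColoring {V : Type*} (G : SimpleGraph V) (σ : V → V → Bool) {k : ℕ}
    (c : V → Fin k) (s : V → Bool) (π : Fin k → Fin k → Bool) : Prop :=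
  ∀ u v, G.Adj u v → c u ≠ c v ∧ π (c u) (c v) = xor (σ u v) (xor (s u) (s v))

theorem exists_sHom_iff {V : Type*} (G : SimpleGraph V) (σ : V → V → Bool) (k : ℕ) :
    (∃ (H : SimpleGraph (Fin k)) (π : Fin k → Fin k → Bool), SHom G σ H π) ↔
      ∃ (c : V → Fin k) (s : V → Bool) (π : Fin k → Fin k → Bool),
        IsSignedColoring G σ c s π := by
  constructor
  · rintro ⟨H, π, φ, σ', ⟨s, hs⟩, h⟩
    exact ⟨φ, s, π, fun u v huv => ⟨(φ.map_adj huv).ne, by rw [h u v huv, hs u v huv]⟩⟩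
  · rintro ⟨c, s, π, h⟩
    exact ⟨⊤, π, ⟨c, fun huv => (h _ _ huv).1⟩, fun u v => xor (σ u v) (xor (s u) (s v)),
      ⟨s, fun _ _ _ => rfl⟩, fun u v huv => (h u v huv).2⟩

theorem IsSignedColoring.castLE {V : Type*} {G : SimpleGraph V} {σ : V → V → Bool} {k l : ℕ}
    (hkl : k ≤ l) {c : V → Fin k} {s : V → Bool} {π : Fin k → Fin k → Bool}
    (h : IsSignedColoring G σ c s π) :
    IsSignedColoring G σ (fun v => Fin.castLE hkl (c v)) s
      (fun a b => if hab : a.1 < k ∧ b.1 < k then π ⟨a, hab.1⟩ ⟨b, hab.2⟩ else false) := by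
  intro u v huv
  refine ⟨fun e => (h u v huv).1 (Fin.castLE_injective hkl e), ?_⟩
  simpa using (h u v huv).2

theorem sChrom_eq {V : Type*} (G : SimpleGraph V) (σ : V → V → Bool) (k : ℕ)
    (hk : ∃ (c : V → Fin (k + 1)) (s : V → Bool) (π : Fin (k + 1) → Fin (k + 1) → Bool),
      IsSignedColoring G σ c s π)
    (hlt : ∀ (c : V → Fin k) (s : V → Bool) (π : Fin k → Fin k → Bool),
      ¬ IsSignedColoring G σ c s π) :
    sChrom G σ = k + 1 := by
  refine le_antisymm (Nat.sInf_le ((exists_sHom_iff G σ _).2 hk)) ?_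
  refine le_csInf ⟨_, (exists_sHom_iff G σ _).2 hk⟩ fun l hl => ?_
  by_contra! hl'
  obtain ⟨c, s, π, h⟩ := (exists_sHom_iff G σ l).1 hl
  exact hlt _ _ _ (h.castLE (Nat.lt_succ_iff.1 hl'))

theorem cycleGraph_adj_iff {m : ℕ} (hm : 3 ≤ m) (u v : Fin m) :
    (cycleGraph m).Adj u v ↔ v = cycleSucc u ∨ u = cycleSucc v := by
  have key : ∀ u v : Fin m, (v - u).val = 1 ↔ v = cycleSucc u := by
    intro u v
    have hu := u.2
    have hv := v.2
    rw [Fin.ext_iff, Fin.val_sub, cycleSucc]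
    dsimp only
    rcases Nat.lt_or_ge (u.1 + 1) m with h | h
    · rw [Nat.mod_eq_of_lt h]
      rcases Nat.lt_or_ge (m - u.1 + v.1) m with h' | h'
      · rw [Nat.mod_eq_of_lt h']; omega
      · rw [Nat.mod_eq_sub_mod h', Nat.mod_eq_of_lt (by omega)]; omega
    · have : u.1 + 1 = m := by omega
      rw [this, Nat.mod_self]
      rcases Nat.lt_or_ge (m - u.1 + v.1) m with h' | h'
      · rw [Nat.mod_eq_of_lt h']; omega
      · rw [Nat.mod_eq_sub_mod h', Nat.mod_eq_of_lt (by omega)]; omega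
  rw [cycleGraph_adj', key, key, or_comm]

theorem cycleSucc_ofNat (m : ℕ) [NeZero m] (i : ℕ) :
    cycleSucc (Fin.ofNat m i) = Fin.ofNat m (i + 1) := by
  ext; simp [cycleSucc]

theorem cycleSucc_bijective (m : ℕ) : Function.Bijective (cycleSucc : Fin m → Fin m) := by
  rw [← Finite.injective_iff_bijective]
  intro u v huv
  have hu := u.2
  have hv := v.2
  simp only [cycleSucc, Fin.mk.injEq] at huv
  ext
  rcases Nat.lt_or_ge (u.1 + 1) m with h | h <;> rcases Nat.lt_or_ge (v.1 + 1) m with h' | h'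
  · rw [Nat.mod_eq_of_lt h, Nat.mod_eq_of_lt h'] at huv; omega
  · rw [show v.1 + 1 = m by omega, Nat.mod_self, Nat.mod_eq_of_lt h] at huv; omega
  · rw [show u.1 + 1 = m by omega, Nat.mod_self, Nat.mod_eq_of_lt h'] at huv; omega
  · omega

theorem sum_eq_sum_of_coboundary {m : ℕ} (F t f : Fin m → ZMod 2)
    (h : ∀ i, F i = t i + f i + f (cycleSucc i)) : ∑ i, F i = ∑ i, t i := by
  simp only [h, Finset.sum_add_distrib]
  rw [(cycleSucc_bijective m).sum_comp f, add_assoc, ZMod.two_add_self, add_zero]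

/-- The sign of a signed cycle as an element of `ZMod 2`. -/
def cycleSign (m : ℕ) (σ : Fin m → Fin m → Bool) : ZMod 2 :=
  ∑ i : Fin m, signBit (σ i (cycleSucc i))

theorem balancedCycleSign_iff (m : ℕ) (σ : Fin m → Fin m → Bool) :
    BalancedCycleSign m σ ↔ cycleSign m σ = 0 := by
  rw [BalancedCycleSign, cycleSign]
  simp only [signBit, Finset.sum_boole]
  rw [ZMod.natCast_eq_zero_iff_even, Nat.even_iff]

section Product

variable {m n : ℕ} {σ₁ : Fin m → Fin m → Bool} {σ₂ : Fin n → Fin n → Bool} {k : ℕ}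
  {c : Fin m × Fin n → Fin k} {s : Fin m × Fin n → Bool} {π : Fin k → Fin k → Bool}

theorem IsSignedColoring.left (hm : 3 ≤ m)
    (h : IsSignedColoring (cycleGraph m □ cycleGraph n) (prodSign σ₁ σ₂) c s π)
    {u u' : Fin m} (hu : u' = cycleSucc u ∨ u = cycleSucc u') (v : Fin n) :
    c (u, v) ≠ c (u', v) ∧ π (c (u, v)) (c (u', v)) =
      xor (σ₁ u u') (xor (s (u, v)) (s (u', v))) := by
  have hadj := (cycleGraph_adj_iff hm u u').2 hu
  have := h (u, v) (u', v) (boxProd_adj_left.2 hadj)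
  simpa [prodSign, hadj.ne] using this

theorem IsSignedColoring.right (hn : 3 ≤ n)
    (h : IsSignedColoring (cycleGraph m □ cycleGraph n) (prodSign σ₁ σ₂) c s π)
    (u : Fin m) {v v' : Fin n} (hv : v' = cycleSucc v ∨ v = cycleSucc v') :
    c (u, v) ≠ c (u, v') ∧ π (c (u, v)) (c (u, v')) =
      xor (σ₂ v v') (xor (s (u, v)) (s (u, v'))) := by
  have hadj := (cycleGraph_adj_iff hn v v').2 hv
  have := h (u, v) (u, v') (boxProd_adj_right.2 hadj)
  simpa [prodSign] using this

/-- The symmetrised signature, with values in `ZMod 2`. -/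
def symmSign (π : Fin k → Fin k → Bool) (a b : Fin k) : ZMod 2 :=
  signBit (if a ≤ b then π a b else π b a)

theorem symmSign_comm (π : Fin k → Fin k → Bool) (a b : Fin k) :
    symmSign π a b = symmSign π b a := by
  unfold symmSign
  rcases lt_trichotomy a b with h | h | h
  · simp [h.le, h.not_ge]
  · simp [h]
  · simp [h.le, h.not_ge]

theorem IsSignedColoring.symmSign_left (hm : 3 ≤ m) (hσ₁ : ∀ u v, σ₁ u v = σ₁ v u)
    (h : IsSignedColoring (cycleGraph m □ cycleGraph n) (prodSign σ₁ σ₂) c s π)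
    (u : Fin m) (v : Fin n) :
    symmSign π (c (u, v)) (c (cycleSucc u, v)) = signBit (σ₁ u (cycleSucc u)) +
      signBit (s (u, v)) + signBit (s (cycleSucc u, v)) := by
  have h1 := (h.left hm (.inl rfl) v : _ ∧ _ = xor (σ₁ u (cycleSucc u)) _).2
  have h2 := (h.left hm (.inr rfl) v : _ ∧ _ = xor (σ₁ (cycleSucc u) u) _).2
  rw [symmSign]
  split
  · rw [h1, signBit_xor, signBit_xor, add_assoc]
  · rw [h2, hσ₁, signBit_xor, signBit_xor]; ring

theorem IsSignedColoring.symmSign_right (hn : 3 ≤ n) (hσ₂ : ∀ u v, σ₂ u v = σ₂ v u)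
    (h : IsSignedColoring (cycleGraph m □ cycleGraph n) (prodSign σ₁ σ₂) c s π)
    (u : Fin m) (v : Fin n) :
    symmSign π (c (u, v)) (c (u, cycleSucc v)) = signBit (σ₂ v (cycleSucc v)) +
      signBit (s (u, v)) + signBit (s (u, cycleSucc v)) := by
  have h1 := (h.right hn u (.inl rfl) : _ ∧ _ = xor (σ₂ v (cycleSucc v)) _).2
  have h2 := (h.right hn u (.inr rfl) : _ ∧ _ = xor (σ₂ (cycleSucc v) v) _).2
  rw [symmSign]
  split
  · rw [h1, signBit_xor, signBit_xor, add_assoc]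
  · rw [h2, hσ₂, signBit_xor, signBit_xor]; ring

theorem IsSignedColoring.even_of_two
    {c : Fin m × Fin n → Fin 2} {π : Fin 2 → Fin 2 → Bool} (hm : 3 ≤ m) (hn : 3 ≤ n)
    (h : IsSignedColoring (cycleGraph m □ cycleGraph n) (prodSign σ₁ σ₂) c s π) :
    Even m ∧ Even n := by
  have key : ∀ a b : Fin 2, a ≠ b → (0 : ZMod 2) = 1 + (![0, 1] : Fin 2 → ZMod 2) a
      + (![0, 1] : Fin 2 → ZMod 2) b := by decide
  constructor
  · have := sum_eq_sum_of_coboundary (m := m) (fun _ => 0) (fun _ => 1)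
      (fun u => (![0, 1] : Fin 2 → ZMod 2) (c (u, ⟨0, by omega⟩)))
      fun u => key _ _ (h.left hm (.inl rfl) _).1
    rw [← ZMod.natCast_eq_zero_iff_even]
    simpa using this.symm
  · have := sum_eq_sum_of_coboundary (m := n) (fun _ => 0) (fun _ => 1)
      (fun v => (![0, 1] : Fin 2 → ZMod 2) (c (⟨0, by omega⟩, v)))
      fun v => key _ _ (h.right hn _ (.inl rfl)).1
    rw [← ZMod.natCast_eq_zero_iff_even]
    simpa using this.symm

theorem exists_eq_const_add_coboundary (τ : Fin 3 → Fin 3 → ZMod 2)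
    (hτ : ∀ a b, τ a b = τ b a) : ∃ (t : ZMod 2) (f : Fin 3 → ZMod 2), ∀ a b, a ≠ b → τ a b = t + f a + f b := by
  have h2 := ZMod.two_add_self
  refine ⟨τ 0 1 + τ 0 2 + τ 1 2, ![0, τ 0 2 + τ 1 2, τ 0 1 + τ 1 2], ?_⟩
  have h10 := hτ 1 0
  have h20 := hτ 2 0
  have h21 := hτ 2 1
  intro a b hab
  fin_cases a <;> fin_cases b <;> simp [*] at hab ⊢ <;> grind

theorem IsSignedColoring.cycleSign_of_three
    {c : Fin m × Fin n → Fin 3} {π : Fin 3 → Fin 3 → Bool} (hm : 3 ≤ m) (hn : 3 ≤ n)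
    (hσ₁ : ∀ u v, σ₁ u v = σ₁ v u) (hσ₂ : ∀ u v, σ₂ u v = σ₂ v u)
    (h : IsSignedColoring (cycleGraph m □ cycleGraph n) (prodSign σ₁ σ₂) c s π) :
    ∃ t : ZMod 2, cycleSign m σ₁ = m * t ∧ cycleSign n σ₂ = n * t := by
  obtain ⟨t, f, ht⟩ := exists_eq_const_add_coboundary (symmSign π) (symmSign_comm π)
  refine ⟨t, ?_, ?_⟩
  · have := sum_eq_sum_of_coboundary (fun u => signBit (σ₁ u (cycleSucc u))) (fun _ => t)
      (fun u => f (c (u, ⟨0, by omega⟩)) + signBit (s (u, ⟨0, by omega⟩))) fun u => by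
        have h1 := h.symmSign_left hm hσ₁ u ⟨0, by omega⟩
        rw [ht _ _ (h.left hm (.inl rfl) _).1] at h1
        have h2 := ZMod.two_add_self
        grind
    simpa [cycleSign] using this
  · have := sum_eq_sum_of_coboundary (fun v => signBit (σ₂ v (cycleSucc v))) (fun _ => t)
      (fun v => f (c (⟨0, by omega⟩, v)) + signBit (s (⟨0, by omega⟩, v))) fun v => by
        have h1 := h.symmSign_right hn hσ₂ ⟨0, by omega⟩ v
        rw [ht _ _ (h.right hn _ (.inl rfl)).1] at h1
        have h2 := ZMod.two_add_self
        grind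
    simpa [cycleSign] using this

theorem map_prod_range_eq_sum {M : Type*} [Monoid M] (A : M → ZMod 2)
    (hA : ∀ x y, A (x * y) = A x + A y) [NeZero m] (f : Fin m → M) :
    A ((List.range m).map fun i => f (Fin.ofNat m i)).prod = ∑ i, A (f i) := by
  have h1 : A 1 = 0 := by simpa using hA 1 1
  have key : ∀ l, A ((List.range l).map fun i => f (Fin.ofNat m i)).prod =
      ∑ i ∈ Finset.range l, A (f (Fin.ofNat m i)) := by
    intro l
    induction l with
    | zero => simpa using h1
    | succ l ih => rw [List.prod_range_succ, hA, ih, Finset.sum_range_succ]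
  rw [key, Finset.sum_range]
  exact Finset.sum_congr rfl fun i _ => by congr 2; ext; simp

theorem IsSignedColoring.det_eq_of_four
    {c : Fin m × Fin n → Fin 4} {π : Fin 4 → Fin 4 → Bool} (hm : 3 ≤ m) (hn : 3 ≤ n)
    (hσ₁ : ∀ u v, σ₁ u v = σ₁ v u) (hσ₂ : ∀ u v, σ₂ u v = σ₂ v u)
    (h : IsSignedColoring (cycleGraph m □ cycleGraph n) (prodSign σ₁ σ₂) c s π) :
    (m : ZMod 2) * cycleSign n σ₂ = n * cycleSign m σ₁ := by
  have : NeZero m := ⟨by omega⟩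
  have : NeZero n := ⟨by omega⟩
  obtain ⟨g, δ, r, hg, hsq⟩ := exists_isDihedralLabel (symmSign π) (symmSign_comm π)
  have hl := fun u v => (h.left hm (.inl rfl) v : c (u, v) ≠ c (cycleSucc u, v) ∧ _).1
  have hr := fun u v => (h.right hn u (.inl rfl) : c (u, v) ≠ c (u, cycleSucc v) ∧ _).1
  have h2 := ZMod.two_add_self
  have hcomm := prod_range_mul_prod_range
    (fun i j => g (c (Fin.ofNat m i, Fin.ofNat n j)) (c (cycleSucc (Fin.ofNat m i), Fin.ofNat n j)))
    (fun i j => g (c (Fin.ofNat m i, Fin.ofNat n j)) (c (Fin.ofNat m i, cycleSucc (Fin.ofNat n j))))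
    (fun i j => by
      simp only [← cycleSucc_ofNat]
      refine hsq _ _ _ _ (hl _ _) (hr _ _) (hr _ _) (hl _ _) ?_
      rw [h.symmSign_left hm hσ₁, h.symmSign_left hm hσ₁, h.symmSign_right hn hσ₂,
        h.symmSign_right hn hσ₂]
      grind) m n
  have hm0 : Fin.ofNat m m = Fin.ofNat m 0 := by ext; simp
  have hn0 : Fin.ofNat n n = Fin.ofNat n 0 := by ext; simp
  simp only [hm0, hn0] at hcomm
  have hdet := dihedral_det_eq_of_commute _ _ hcomm
  rw [map_prod_range_eq_sum _ dihedralFst_mul (fun u => g (c (u, _)) (c (cycleSucc u, _))),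
    map_prod_range_eq_sum _ dihedralFst_mul (fun v => g (c (_, v)) (c (_, cycleSucc v))),
    map_prod_range_eq_sum _ dihedralSnd_mul (fun u => g (c (u, _)) (c (cycleSucc u, _))),
    map_prod_range_eq_sum _ dihedralSnd_mul (fun v => g (c (_, v)) (c (_, cycleSucc v)))] at hdet
  rw [sum_eq_sum_of_coboundary _ (fun _ => 1) (fun u => δ (c (u, _)))
      fun u => (hg _ _ (hl u _)).1,
    sum_eq_sum_of_coboundary _ (fun _ => 1) (fun v => δ (c (_, v)))
      fun v => (hg _ _ (hr _ v)).1,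
    sum_eq_sum_of_coboundary (fun u => dihedralSnd (g (c (u, _)) (c (cycleSucc u, _))))
      (fun u => signBit (σ₁ u (cycleSucc u)))
      (fun u => r (c (u, Fin.ofNat n 0)) + signBit (s (u, Fin.ofNat n 0)))
      fun u => by rw [(hg _ _ (hl u _)).2, h.symmSign_left hm hσ₁]; ring,
    sum_eq_sum_of_coboundary (fun v => dihedralSnd (g (c (_, v)) (c (_, cycleSucc v))))
      (fun v => signBit (σ₂ v (cycleSucc v)))
      (fun v => r (c (Fin.ofNat m 0, v)) + signBit (s (Fin.ofNat m 0, v)))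
      fun v => by rw [(hg _ _ (hr _ v)).2, h.symmSign_right hn hσ₂]; ring] at hdet
  simpa [cycleSign] using hdet

end Product

/-- The element `ω` if the sign is negative, and `0` otherwise. -/
def signShift {Γ : Type*} [Zero Γ] (ω : Γ) (b : Bool) : Γ := if b then ω else 0

/-- A signed Cayley graph presented by its double cover: `Γ` is an abelian group, `ω` an element
of order two acting as negation, `T` the set of steps of positive edges. The vertices of the signed
graph are the fibres of `κ`, and `S` tells the two elements of each fibre apart. -/
structure SignedCayley (Γ : Type*) [AddCommGroup Γ] (k : ℕ) where
  /-- The deck transformation. -/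
  ω : Γ
  /-- The steps of positive edges. -/
  T : Finset Γ
  /-- The projection to the vertices. -/
  κ : Γ → Fin k
  /-- The sheet of an element. -/
  S : Γ → Bool
  /-- The signature. -/
  π : Fin k → Fin k → Bool
  ω_add_ω : ω + ω = 0
  neg_mem : ∀ t ∈ T, -t ∈ T
  κ_add_ω : ∀ z, κ (z + ω) = κ z
  S_add_ω : ∀ z, S (z + ω) = !S z
  edge : ∀ z, ∀ t ∈ T, κ z ≠ κ (z + t) ∧ π (κ z) (κ (z + t)) = xor (S z) (S (z + t))

namespace SignedCayley

variable {Γ : Type*} [AddCommGroup Γ] {k : ℕ} (D : SignedCayley Γ k)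

theorem edge_of_sub_mem {z z' : Γ} {b : Bool} (h : z' - z - signShift D.ω b ∈ D.T) :
    D.κ z ≠ D.κ z' ∧ D.π (D.κ z) (D.κ z') = xor b (xor (D.S z) (D.S z')) := by
  have h1 := D.edge z _ h
  cases b with
  | false => simpa [signShift] using h1
  | true =>
    have h2 : z + (z' - z - signShift D.ω true) = z' + D.ω := by
      rw [signShift, if_pos rfl, ← sub_eq_zero, ← neg_eq_zero, ← D.ω_add_ω]; abel
    rw [h2, D.κ_add_ω, D.S_add_ω] at h1
    simpa using h1

theorem sub_mem_symm {z z' : Γ} {b : Bool} (h : z' - z - signShift D.ω b ∈ D.T) :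
    z - z' - signShift D.ω b ∈ D.T := by
  convert D.neg_mem _ h using 1
  have h2 : signShift D.ω b + signShift D.ω b = 0 := by
    cases b <;> simp [signShift, D.ω_add_ω]
  rw [← sub_eq_zero, ← neg_eq_zero, ← h2]
  abel

variable {m n : ℕ}

/-- A closed walk of length `m` in the signed Cayley graph following the signs `σ`. -/
def HasClosedWalk (σ : Fin m → Fin m → Bool) : Prop :=
  ∃ x : Fin m → Γ, ∀ i, x (cycleSucc i) - x i - signShift D.ω (σ i (cycleSucc i)) ∈ D.T

theorem exists_isSignedColoring (hm : 3 ≤ m) (hn : 3 ≤ n)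
    {σ₁ : Fin m → Fin m → Bool} (hσ₁ : ∀ u v, σ₁ u v = σ₁ v u)
    {σ₂ : Fin n → Fin n → Bool} (hσ₂ : ∀ u v, σ₂ u v = σ₂ v u)
    (h₁ : D.HasClosedWalk σ₁) (h₂ : D.HasClosedWalk σ₂) :
    ∃ (c : Fin m × Fin n → Fin k) (s : Fin m × Fin n → Bool) (π : Fin k → Fin k → Bool),
      IsSignedColoring (cycleGraph m □ cycleGraph n) (prodSign σ₁ σ₂) c s π := by
  obtain ⟨x, hx⟩ := h₁
  obtain ⟨y, hy⟩ := h₂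
  have hx' : ∀ u u', (cycleGraph m).Adj u u' → x u' - x u - signShift D.ω (σ₁ u u') ∈ D.T := by
    intro u u' h
    rcases (cycleGraph_adj_iff hm u u').1 h with rfl | rfl
    · exact hx u
    · rw [hσ₁]; exact D.sub_mem_symm (hx u')
  have hy' : ∀ v v', (cycleGraph n).Adj v v' → y v' - y v - signShift D.ω (σ₂ v v') ∈ D.T := by
    intro v v' h
    rcases (cycleGraph_adj_iff hn v v').1 h with rfl | rfl
    · exact hy v
    · rw [hσ₂]; exact D.sub_mem_symm (hy v')
  refine ⟨fun p => D.κ (x p.1 + y p.2), fun p => D.S (x p.1 + y p.2), D.π, ?_⟩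
  rintro ⟨u, v⟩ ⟨u', v'⟩ h
  apply D.edge_of_sub_mem
  rcases boxProd_adj.1 h with ⟨h, rfl : v = v'⟩ | ⟨h, rfl : u = u'⟩
  · simpa [prodSign, h.ne] using hx' u u' h
  · simpa [prodSign] using hy' v v' h

theorem exists_sub_eq_of_sum_eq_zero (a : Fin m → Γ) (ha : ∑ i, a i = 0) :
    ∃ x : Fin m → Γ, ∀ i, x (cycleSucc i) - x i = a i := by
  set b : ℕ → Γ := fun k => if h : k < m then a ⟨k, h⟩ else 0 with hb
  have hba : ∀ i : Fin m, b i = a i := fun i => by simp [hb]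
  refine ⟨fun i => ∑ k ∈ Finset.range i, b k, fun i => ?_⟩
  rw [← hba i, sub_eq_iff_eq_add', ← Finset.sum_range_succ]
  rcases Nat.lt_or_ge (i.1 + 1) m with h | h
  · rw [cycleSucc]; dsimp only; rw [Nat.mod_eq_of_lt h]
  · have h' : i.1 + 1 = m := by have := i.2; omega
    rw [cycleSucc]; dsimp only
    rw [h', Nat.mod_self, Finset.sum_range_zero, Finset.sum_range]
    simp only [hba, ha]

open Classical in
theorem sum_signShift (ω : Γ) (hω : ω + ω = 0) (σ : Fin m → Fin m → Bool) :
    ∑ i, signShift ω (σ i (cycleSucc i)) = if BalancedCycleSign m σ then 0 else ω := by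
  simp only [signShift]
  rw [← Finset.sum_filter, Finset.sum_const]
  set N := (Finset.univ.filter fun i : Fin m => σ i (cycleSucc i) = true).card
  have hN : BalancedCycleSign m σ ↔ N % 2 = 0 := Iff.rfl
  rw [← two_nsmul] at hω
  have : N • ω = (N % 2) • ω := by
    conv_lhs => rw [← Nat.mod_add_div N 2, add_nsmul, mul_nsmul, hω, nsmul_zero, add_zero]
  rw [this]
  rcases Nat.mod_two_eq_zero_or_one N with h | h <;> simp [h, hN]

/-- There is a walk of length `l` with displacement `z`, using only positive steps. -/
def Reaches (l : ℕ) (z : Γ) : Prop :=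
  ∃ L : List Γ, L.length = l ∧ (∀ t ∈ L, t ∈ D.T) ∧ L.sum = z

variable {D}

theorem Reaches.add_two_mul {l : ℕ} {z : Γ} (h : D.Reaches l z) (hT : D.T.Nonempty) (j : ℕ) :
    D.Reaches (l + 2 * j) z := by
  obtain ⟨t, ht⟩ := hT
  induction j with
  | zero => exact h
  | succ j ih =>
    obtain ⟨L, hl, hL, hs⟩ := ih
    refine ⟨t :: -t :: L, by simp [hl]; ring, ?_, by simp [hs]⟩
    simpa [ht, D.neg_mem t ht] using hL

theorem Reaches.of_le {l m : ℕ} {z : Γ} (h : D.Reaches l z) (hT : D.T.Nonempty) (hlm : l ≤ m)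
    (hpar : Even l ↔ Even m) : D.Reaches m z := by
  have h2 : Even (m - l) := (Nat.even_sub hlm).2 hpar.symm
  obtain ⟨j, hj⟩ := h2
  convert h.add_two_mul hT j using 1
  omega

theorem Reaches.hasClosedWalk {σ : Fin m → Fin m → Bool} {z : Γ} (h : D.Reaches m z)
    (hz : (BalancedCycleSign m σ ∧ z = 0) ∨ (¬ BalancedCycleSign m σ ∧ z = D.ω)) :
    D.HasClosedWalk σ := by
  obtain ⟨L, rfl, hL, hs⟩ := h
  obtain ⟨x, hx⟩ := exists_sub_eq_of_sum_eq_zero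
    (fun i : Fin L.length => L[i.1] + signShift D.ω (σ i (cycleSucc i))) (by
      rw [Finset.sum_add_distrib, Fin.sum_univ_getElem, hs, sum_signShift _ D.ω_add_ω]
      rcases hz with ⟨hb, rfl⟩ | ⟨hb, rfl⟩ <;> simp [hb, D.ω_add_ω])
  refine ⟨x, fun i => ?_⟩
  rw [hx, add_sub_cancel_right]
  exact hL _ (List.getElem_mem _)

end SignedCayley

/-- The positive edge `K₂`. -/
def cayleyTwo : SignedCayley (ZMod 2 × ZMod 2) 2 where
  ω := (0, 1)
  T := {(1, 0)}
  κ z := Fin.ofNat 2 z.1.val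
  S z := z.2 = 1
  π _ _ := false
  ω_add_ω := by decide
  neg_mem := by decide
  κ_add_ω := by decide
  S_add_ω := by decide
  edge := by decide

/-- The positive triangle. -/
def cayleyThreePos : SignedCayley (ZMod 6) 3 where
  ω := 3
  T := {2, 4}
  κ z := Fin.ofNat 3 z.val
  S z := z.val % 2 = 1
  π _ _ := false
  ω_add_ω := by decide
  neg_mem := by decide
  κ_add_ω := by decide
  S_add_ω := by decide
  edge := by decide

/-- The negative triangle. -/
def cayleyThreeNeg : SignedCayley (ZMod 6) 3 where
  ω := 3
  T := {1, 5}
  κ z := Fin.ofNat 3 z.val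
  S z := z.val % 2 = 1
  π _ _ := true
  ω_add_ω := by decide
  neg_mem := by decide
  κ_add_ω := by decide
  S_add_ω := by decide
  edge := by decide

/-- The unbalanced 4-cycle. -/
def cayleyFour : SignedCayley (ZMod 8) 4 where
  ω := 4
  T := {1, 7}
  κ z := Fin.ofNat 4 z.val
  S z := 4 ≤ z.val
  π a b := (a = 0 ∧ b = 3) ∨ (a = 3 ∧ b = 0)
  ω_add_ω := by decide
  neg_mem := by decide
  κ_add_ω := by decide
  S_add_ω := by decide
  edge := by decide

/-- The signed complete graph `K₅` whose negative edges form a 5-cycle. -/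
def cayleyFive : SignedCayley (ZMod 10) 5 where
  ω := 5
  T := {3, 4, 6, 7}
  κ z := Fin.ofNat 5 z.val
  S z := z.val % 2 = 1
  π a b := a = b + 2 ∨ b = a + 2
  ω_add_ω := by decide
  neg_mem := by decide
  κ_add_ω := by decide
  S_add_ω := by decide
  edge := by decide

theorem cayleyTwo_hasClosedWalk {m : ℕ} {σ : Fin m → Fin m → Bool} (hm : Even m)
    (hb : BalancedCycleSign m σ) : cayleyTwo.HasClosedWalk σ :=
  SignedCayley.Reaches.hasClosedWalk
    (.of_le (l := 0) ⟨[], rfl, by decide, rfl⟩ (by decide) (Nat.zero_le m) (by simpa using hm))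
    (.inl ⟨hb, rfl⟩)

theorem cayleyThreePos_hasClosedWalk {m : ℕ} {σ : Fin m → Fin m → Bool} (hm : 3 ≤ m)
    (hb : BalancedCycleSign m σ) : cayleyThreePos.HasClosedWalk σ := by
  rcases Nat.even_or_odd m with he | ho
  · exact SignedCayley.Reaches.hasClosedWalk (.of_le (l := 0) ⟨[], rfl, by decide, rfl⟩ (by decide)
      (Nat.zero_le m) (by simpa using he)) (.inl ⟨hb, rfl⟩)
  · exact SignedCayley.Reaches.hasClosedWalk (.of_le (l := 3) ⟨[2, 2, 2], rfl, by decide, rfl⟩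
      (by decide) hm (by simpa [Nat.even_iff, Nat.odd_iff] using ho)) (.inl ⟨hb, rfl⟩)

theorem cayleyThreeNeg_hasClosedWalk {m : ℕ} {σ : Fin m → Fin m → Bool} (hm : 3 ≤ m)
    (hb : BalancedCycleSign m σ ↔ Even m) : cayleyThreeNeg.HasClosedWalk σ := by
  rcases Nat.even_or_odd m with he | ho
  · exact SignedCayley.Reaches.hasClosedWalk (.of_le (l := 0) ⟨[], rfl, by decide, rfl⟩ (by decide)
      (Nat.zero_le m) (by simpa using he)) (.inl ⟨hb.2 he, rfl⟩)
  · exact SignedCayley.Reaches.hasClosedWalk (.of_le (l := 3) ⟨[1, 1, 1], rfl, by decide, rfl⟩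
      (by decide) hm (by simpa [Nat.even_iff, Nat.odd_iff] using ho))
      (.inr ⟨fun h => Nat.not_even_iff_odd.2 ho (hb.1 h), rfl⟩)

theorem cayleyFour_hasClosedWalk {m : ℕ} {σ : Fin m → Fin m → Bool} (hm : 3 ≤ m)
    (he : Even m) : cayleyFour.HasClosedWalk σ := by
  by_cases hb : BalancedCycleSign m σ
  · exact SignedCayley.Reaches.hasClosedWalk (.of_le (l := 0) ⟨[], rfl, by decide, rfl⟩ (by decide)
      (Nat.zero_le m) (by simpa using he)) (.inl ⟨hb, rfl⟩)
  · exact SignedCayley.Reaches.hasClosedWalk (.of_le (l := 4) ⟨[1, 1, 1, 1], rfl, by decide, rfl⟩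
      (by decide) (by grind) (by simpa [Nat.even_iff] using he)) (.inr ⟨hb, rfl⟩)

theorem cayleyFive_hasClosedWalk {m : ℕ} {σ : Fin m → Fin m → Bool} (hm : 3 ≤ m) :
    cayleyFive.HasClosedWalk σ := by
  by_cases hb : BalancedCycleSign m σ <;> rcases Nat.even_or_odd m with he | ho
  · exact SignedCayley.Reaches.hasClosedWalk (.of_le (l := 0) ⟨[], rfl, by decide, rfl⟩ (by decide)
      (Nat.zero_le m) (by simpa using he)) (.inl ⟨hb, rfl⟩)
  · exact SignedCayley.Reaches.hasClosedWalk (.of_le (l := 3) ⟨[3, 3, 4], rfl, by decide, rfl⟩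
      (by decide) hm (by simpa [Nat.even_iff, Nat.odd_iff] using ho)) (.inl ⟨hb, rfl⟩)
  · exact SignedCayley.Reaches.hasClosedWalk (.of_le (l := 4) ⟨[6, 6, 6, 7], rfl, by decide, rfl⟩
      (by decide) (by grind) (by simpa [Nat.even_iff] using he)) (.inr ⟨hb, rfl⟩)
  · exact SignedCayley.Reaches.hasClosedWalk (.of_le (l := 3) ⟨[6, 6, 3], rfl, by decide, rfl⟩
      (by decide) hm (by simpa [Nat.even_iff, Nat.odd_iff] using ho)) (.inr ⟨hb, rfl⟩)

/-- The chromatic number of the Cartesian product of two signed cycles,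
according to the types (balanced/unbalanced, even/odd length) of the two
cycles. -/
theorem chrom_boxProd_cycles (m n : ℕ) (hm : 3 ≤ m) (hn : 3 ≤ n)
    (σ₁ : Fin m → Fin m → Bool) (hσ₁ : ∀ u v, σ₁ u v = σ₁ v u)
    (σ₂ : Fin n → Fin n → Bool) (hσ₂ : ∀ u v, σ₂ u v = σ₂ v u) :
    (BalancedCycleSign m σ₁ ∧ Even m ∧ BalancedCycleSign n σ₂ ∧ Even n →
      sChrom (cycleGraph m □ cycleGraph n) (prodSign σ₁ σ₂) = 2) ∧
    (Even m ∧ Even n ∧ (¬ BalancedCycleSign m σ₁ ∨ ¬ BalancedCycleSign n σ₂) →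
      sChrom (cycleGraph m □ cycleGraph n) (prodSign σ₁ σ₂) = 4) ∧
    ((BalancedCycleSign m σ₁ ∧ Even m ∧ Odd n) ∨
     (BalancedCycleSign n σ₂ ∧ Even n ∧ Odd m) ∨
     (Odd m ∧ Odd n ∧ (BalancedCycleSign m σ₁ ↔ BalancedCycleSign n σ₂)) →
      sChrom (cycleGraph m □ cycleGraph n) (prodSign σ₁ σ₂) = 3) ∧
    ((¬ BalancedCycleSign m σ₁ ∧ Even m ∧ Odd n) ∨
     (¬ BalancedCycleSign n σ₂ ∧ Even n ∧ Odd m) ∨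
     (Odd m ∧ Odd n ∧ ¬ (BalancedCycleSign m σ₁ ↔ BalancedCycleSign n σ₂)) →
      sChrom (cycleGraph m □ cycleGraph n) (prodSign σ₁ σ₂) = 5) := by
  have : NeZero m := ⟨by omega⟩
  have : NeZero n := ⟨by omega⟩
  have z2 : ∀ t : ZMod 2, t = 0 ∨ t = 1 := by decide
  have hcast : ∀ l : ℕ, (Even l ∧ (l : ZMod 2) = 0) ∨ (Odd l ∧ (l : ZMod 2) = 1) := by
    intro l
    rcases Nat.even_or_odd l with h | h
    · exact .inl ⟨h, ZMod.natCast_eq_zero_iff_even.2 h⟩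
    · exact .inr ⟨h, ZMod.natCast_eq_one_iff_odd.2 h⟩
  refine ⟨?_, ?_, ?_, ?_⟩
  · rintro ⟨hb₁, hm₂, hb₂, hn₂⟩
    refine sChrom_eq _ _ 1 (cayleyTwo.exists_isSignedColoring hm hn hσ₁ hσ₂
      (cayleyTwo_hasClosedWalk hm₂ hb₁) (cayleyTwo_hasClosedWalk hn₂ hb₂)) fun c s π h => ?_
    exact (h.left hm (.inl rfl : cycleSucc 0 = cycleSucc 0 ∨ _) 0).1 (Subsingleton.elim _ _)
  · rintro ⟨hm₂, hn₂, hb⟩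
    refine sChrom_eq _ _ 3 (cayleyFour.exists_isSignedColoring hm hn hσ₁ hσ₂
      (cayleyFour_hasClosedWalk hm hm₂) (cayleyFour_hasClosedWalk hn hn₂)) fun c s π h => ?_
    obtain ⟨t, h₁, h₂⟩ := h.cycleSign_of_three hm hn hσ₁ hσ₂
    rw [balancedCycleSign_iff, balancedCycleSign_iff, h₁, h₂,
      ZMod.natCast_eq_zero_iff_even.2 hm₂, ZMod.natCast_eq_zero_iff_even.2 hn₂] at hb
    simp at hb
  · intro hb
    have hodd : ¬ (Even m ∧ Even n) := by
      simp only [← Nat.not_even_iff_odd] at hb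
      tauto
    refine sChrom_eq _ _ 2 ?_ fun c s π h => hodd (h.even_of_two hm hn)
    by_cases hpos : BalancedCycleSign m σ₁ ∧ BalancedCycleSign n σ₂
    · exact cayleyThreePos.exists_isSignedColoring hm hn hσ₁ hσ₂
        (cayleyThreePos_hasClosedWalk hm hpos.1) (cayleyThreePos_hasClosedWalk hn hpos.2)
    · simp only [← Nat.not_even_iff_odd] at hb
      exact cayleyThreeNeg.exists_isSignedColoring hm hn hσ₁ hσ₂
        (cayleyThreeNeg_hasClosedWalk hm (by tauto)) (cayleyThreeNeg_hasClosedWalk hn (by tauto))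
  · intro hb
    refine sChrom_eq _ _ 4 (cayleyFive.exists_isSignedColoring hm hn hσ₁ hσ₂
      (cayleyFive_hasClosedWalk hm) (cayleyFive_hasClosedWalk hn)) fun c s π h => ?_
    have hdet := h.det_eq_of_four hm hn hσ₁ hσ₂
    rw [balancedCycleSign_iff, balancedCycleSign_iff] at hb
    simp only [← Nat.not_even_iff_odd] at hb hcast
    rcases hcast m with ⟨h₁, h₁'⟩ | ⟨h₁, h₁'⟩ <;> rcases hcast n with ⟨h₂, h₂'⟩ | ⟨h₂, h₂'⟩ <;>
      rcases z2 (cycleSign m σ₁) with h₃ | h₃ <;> rcases z2 (cycleSign n σ₂) with h₄ | h₄ <;>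
      simp [h₁, h₁', h₂, h₂', h₃, h₄] at hb hdet
end
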